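/- Let F be a finite field, let k, v, r be positive integers with v − k < r ≤ v, let A ∈ F^{k×v} be a generalized Cauchy matrix, and let s, t ∈ ℕ with 2s + t ≤ v. If x and y are codewords of the extended Cauchy code C(A,k,v,r), E ⊆ {1,…,k+r} is a set of coordinates with |E| ≤ t, and the number of coordinates outside E at which x and y differ is at most 2s, then x = y. (This expresses that C(A,k,v,r) corrects any combination of s errors and t erasures with 2s + t ≤ v.) -/

import Mathlib

/-- The extended Cauchy (EC) code `C(A,k,v,r)`: the right kernel of the
parity-check matrix `H = [A; -I_r 0]ᵀ`, viewed as a set of vectors of length `k + r`. -/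
def ECCode {F : Type} [Field F] {k v : ℕ} (A : Matrix (Fin k) (Fin v) F) (r : ℕ)
    (hrv : r ≤ v) : Set (Fin (k + r) → F) :=
  {x | (∀ j : Fin r,
          ∑ i : Fin k, x (Fin.castAdd r i) * A i (Fin.castLE hrv j) = x (Fin.natAdd k j)) ∧
       ∀ j : Fin v, r ≤ (j : ℕ) → ∑ i : Fin k, x (Fin.castAdd r i) * A i j = 0}

open Polynomial in
/-- A partial fraction with simple poles indexed by `S` and with at least `#S` zeros vanishes. -/
theorem eq_zero_of_sum_div_sub_eq_zero {F ι κ : Type*} [Field F] {S : Finset ι} {T : Finset κ}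
    {a : ι → F} {b : κ → F} {u : ι → F} (ha : Set.InjOn a S) (hb : Set.InjOn b T)
    (hab : ∀ i ∈ S, ∀ j ∈ T, a i ≠ b j) (hST : S.card ≤ T.card)
    (hsum : ∀ j ∈ T, ∑ i ∈ S, u i / (a i - b j) = 0) : ∀ i ∈ S, u i = 0 := by
  classical
  set P : F[X] := ∑ i ∈ S, C (u i) * ∏ l ∈ S.erase i, (X - C (a l)) with hP
  have hdeg : P.degree < T.card := by
    refine lt_of_lt_of_le ?_ (Nat.cast_le.2 hST)
    rw [hP, degree_lt_iff_coeff_zero]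
    intro m hm
    rw [finsetSum_coeff]
    refine Finset.sum_eq_zero fun i hi => ?_
    have hcard := Finset.card_erase_lt_of_mem hi
    rw [coeff_C_mul, coeff_eq_zero_of_natDegree_lt, mul_zero]
    rw [natDegree_finsetProd_X_sub_C_eq_card]
    omega
  have hzero : P = 0 := by
    refine eq_zero_of_degree_lt_of_eval_index_eq_zero T hb hdeg fun j hj => ?_
    have hterm : P.eval (b j) =
        -((∏ l ∈ S, (b j - a l)) * ∑ i ∈ S, u i / (a i - b j)) := by
      rw [hP, eval_finsetSum, Finset.mul_sum, ← Finset.sum_neg_distrib]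
      refine Finset.sum_congr rfl fun i hi => ?_
      have hne : a i - b j ≠ 0 := sub_ne_zero.2 (hab i hi j hj)
      rw [← Finset.mul_prod_erase S _ hi]
      simp only [eval_mul, eval_C, eval_prod, eval_sub, eval_X]
      field_simp
      ring
    rw [hterm, hsum j hj, mul_zero, neg_zero]
  intro i hi
  have heval : P.eval (a i) = u i * ∏ l ∈ S.erase i, (a i - a l) := by
    rw [hP, eval_finsetSum, Finset.sum_eq_single_of_mem i hi]
    · simp [eval_prod]
    · intro l _ hli
      rw [eval_mul, eval_prod,
        Finset.prod_eq_zero (Finset.mem_erase.2 ⟨hli.symm, hi⟩) (by simp), mul_zero]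
  rw [hzero, eval_zero] at heval
  refine (mul_eq_zero.1 heval.symm).resolve_right (Finset.prod_ne_zero_iff.2 fun l hl => ?_)
  obtain ⟨hli, hl⟩ := Finset.mem_erase.1 hl
  exact sub_ne_zero.2 fun h => hli (ha hi hl h).symm

theorem ECCode.sub_mem {F : Type} [Field F] {k v r : ℕ} {A : Matrix (Fin k) (Fin v) F}
    {hrv : r ≤ v} {x y : Fin (k + r) → F} (hx : x ∈ ECCode A r hrv) (hy : y ∈ ECCode A r hrv) :
    x - y ∈ ECCode A r hrv := by
  refine ⟨fun j => ?_, fun j hj => ?_⟩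
  · simp [sub_mul, Finset.sum_sub_distrib, hx.1 j, hy.1 j]
  · simp [sub_mul, Finset.sum_sub_distrib, hx.2 j hj, hy.2 j hj]

/-- A nonzero codeword of an extended Cauchy code has weight greater than `v`. -/
theorem ECCode.eq_zero_of_card_support_le {F : Type} [Field F] [DecidableEq F] {k v r : ℕ}
    {hrv : r ≤ v} {a : Fin k → F} {b : Fin v → F} {c : Fin k → F} {d : Fin v → F}
    (hdist : Function.Injective (Sum.elim a b)) (hc : ∀ i, c i ≠ 0) (hd : ∀ j, d j ≠ 0)
    {A : Matrix (Fin k) (Fin v) F} (hA : ∀ i j, A i j = c i * d j / (a i - b j))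
    {z : Fin (k + r) → F} (hz : z ∈ ECCode A r hrv)
    (hcard : (Finset.univ.filter fun i => z i ≠ 0).card ≤ v) : z = 0 := by
  obtain ⟨ha, hb, hab⟩ := Sum.elim_injective.1 hdist
  let S : Finset (Fin k) := Finset.univ.filter fun i => z (Fin.castAdd r i) ≠ 0
  let R : Finset (Fin r) := Finset.univ.filter fun j => z (Fin.natAdd k j) ≠ 0
  let T : Finset (Fin v) := (R.image (Fin.castLE hrv))ᶜ
  have hSR : S.card + R.card ≤ v := by
    have hle : ((S.disjSum R).map finSumFinEquiv.toEmbedding).card ≤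
        (Finset.univ.filter fun i => z i ≠ 0).card := by
      refine Finset.card_le_card fun i hi => ?_
      obtain ⟨p, hp, rfl⟩ := Finset.mem_map.1 hi
      rcases p with p | p <;> simpa [S, R] using hp
    rw [Finset.card_map, Finset.card_disjSum] at hle
    omega
  have hST : S.card ≤ T.card := by
    have hR : (R.image (Fin.castLE hrv)).card ≤ R.card := Finset.card_image_le
    rw [Finset.card_compl, Fintype.card_fin]
    omega
  have hT : ∀ j ∈ T, ∑ i, z (Fin.castAdd r i) * A i j = 0 := by
    intro j hj
    rcases lt_or_ge (j : ℕ) r with hjr | hjr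
    · have hj' : (⟨j, hjr⟩ : Fin r) ∉ R := fun h =>
        Finset.mem_compl.1 hj (Finset.mem_image.2 ⟨_, h, rfl⟩)
      refine (hz.1 ⟨j, hjr⟩).trans ?_
      simpa [R] using hj'
    · exact hz.2 j hjr
  have hu := eq_zero_of_sum_div_sub_eq_zero (u := fun i => z (Fin.castAdd r i) * c i)
    ha.injOn hb.injOn (fun i _ j _ => hab i j) hST fun j hj => by
      refine (mul_eq_zero.1 (?_ : d j * _ = 0)).resolve_left (hd j)
      rw [← hT j hj, Finset.mul_sum,
        ← Finset.sum_subset (Finset.subset_univ S) (by intro i _ hi; simp_all [S])]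
      refine Finset.sum_congr rfl fun i _ => ?_
      rw [hA]
      ring
  have hinfo : ∀ i, z (Fin.castAdd r i) = 0 := by
    intro i
    by_contra h
    exact mul_ne_zero h (hc i) (hu i (by simpa [S] using h))
  funext i
  refine Fin.addCases hinfo (fun j => ?_) i
  simp [← hz.1 j, hinfo]

/-- the EC code `C(A,k,v,r)` corrects any combination of `s` errors and
`t` erasures with `2s + t ≤ v`: if two codewords agree outside a set `E` of at most `t`
erased coordinates except on at most `2s` coordinates, they are equal. -/
theorem ec_code_corrects_errors_and_erasures {F : Type} [Field F] [Fintype F]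
    [DecidableEq F]
    (k v r : ℕ) (hk : 0 < k) (hr : 0 < r) (hrv : r ≤ v) (hvk : v - k < r)
    (a : Fin k → F) (b : Fin v → F) (c : Fin k → F) (d : Fin v → F)
    (hdist : Function.Injective (Sum.elim a b))
    (hc : ∀ i, c i ≠ 0) (hd : ∀ j, d j ≠ 0)
    (A : Matrix (Fin k) (Fin v) F)
    (hA : ∀ i j, A i j = c i * d j / (a i - b j))
    (s t : ℕ) (hst : 2 * s + t ≤ v)
    (x y : Fin (k + r) → F)
    (hx : x ∈ ECCode A r hrv) (hy : y ∈ ECCode A r hrv)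
    (E : Finset (Fin (k + r))) (hE : E.card ≤ t)
    (herr : (Finset.univ.filter fun i => i ∉ E ∧ x i ≠ y i).card ≤ 2 * s) :
    x = y := by
  have hle : (Finset.univ.filter fun i => (x - y) i ≠ 0).card ≤
      (E ∪ Finset.univ.filter fun i => i ∉ E ∧ x i ≠ y i).card := by
    refine Finset.card_le_card fun i hi => ?_
    by_cases hiE : i ∈ E <;> simp_all [sub_ne_zero]
  have hunion := hle.trans (Finset.card_union_le _ _)
  exact sub_eq_zero.1 <| ECCode.eq_zero_of_card_support_le hdist hc hd hA
    (ECCode.sub_mem hx hy) (by omega)
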